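/- Let h : ℝ^d → ℝ be α-Hölder for some α ∈ (0,1], and let f_h(x) = −∫₀¹ (1/(2t)) E[ h̄(√t x + √(1−t) Z) ] dt with h̄ = h − E h(Z), Z ~ N(0, I_d). Then for every β ∈ (0, α) and all x, y ∈ ℝ^d, |Δf_h(x) − Δf_h(y)| ≤ (C₂(α,d) + 2d/(α−β)) |x−y|^β [h]_α, where C₂(α,d) = 2^{α/2+1} (α+2d) Γ((α+d)/2)/(α Γ(d/2)) for α ∈ (0,1) and C₂(1,d) = 2 √(2/π) √d. -/

import Mathlib

open MeasureTheory ProbabilityTheory Real Filter Set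

noncomputable section

/-- The standard Gaussian measure `N(0, I_d)` on `ℝ^d` (as `EuclideanSpace ℝ (Fin d)`). -/
def stdGaussian (d : ℕ) : Measure (EuclideanSpace ℝ (Fin d)) :=
  (Measure.pi fun _ : Fin d => gaussianReal 0 1).map
    ⇑(EuclideanSpace.equiv (Fin d) ℝ).symm

/-- Partial derivative in the `j`-th coordinate direction. -/
def pderivI {d : ℕ} (j : Fin d) (f : EuclideanSpace ℝ (Fin d) → ℝ) :
    EuclideanSpace ℝ (Fin d) → ℝ :=
  fun x => fderiv ℝ f x (EuclideanSpace.single j 1)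

/-- Iterated partial derivative along a list of coordinate directions (head applied last,
i.e. outermost). -/
def pderivList {d : ℕ} : List (Fin d) → (EuclideanSpace ℝ (Fin d) → ℝ) →
    EuclideanSpace ℝ (Fin d) → ℝ
  | [], f => f
  | j :: l, f => pderivI j (pderivList l f)

/-- Multi-index partial derivative `∂^{|m|}/(∂x₁^{m₁} ⋯ ∂x_d^{m_d})`. -/
def pderivMulti {d : ℕ} (m : Fin d → ℕ) (f : EuclideanSpace ℝ (Fin d) → ℝ) :
    EuclideanSpace ℝ (Fin d) → ℝ :=
  pderivList ((List.finRange d).flatMap fun j => List.replicate (m j) j) f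

/-- Multivariate Hermite polynomial
`H_m(x) = (-1)^{|m|} e^{|x|²/2} ∂^{|m|}/(∂x₁^{m₁} ⋯ ∂x_d^{m_d}) e^{-|x|²/2}`. -/
def hermiteMulti {d : ℕ} (m : Fin d → ℕ) (x : EuclideanSpace ℝ (Fin d)) : ℝ :=
  (-1 : ℝ) ^ (∑ j, m j) * Real.exp (‖x‖ ^ 2 / 2) *
    pderivMulti m (fun y => Real.exp (-‖y‖ ^ 2 / 2)) x

/-- `h̄ = h - E h(Z)` with `Z ~ N(0, I_d)`. -/
def hbar (d : ℕ) (h : EuclideanSpace ℝ (Fin d) → ℝ) (x : EuclideanSpace ℝ (Fin d)) : ℝ :=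
  h x - ∫ z, h z ∂(stdGaussian d)

/-- Barbour's solution `f_h(x) = -∫₀¹ (1/(2t)) E[ h̄(√t x + √(1-t) Z) ] dt` of the
multivariate Stein equation. -/
def steinSol (d : ℕ) (h : EuclideanSpace ℝ (Fin d) → ℝ) (x : EuclideanSpace ℝ (Fin d)) : ℝ :=
  -∫ t in Ioo (0 : ℝ) 1,
      (1 / (2 * t)) *
        ∫ z, hbar d h (Real.sqrt t • x + Real.sqrt (1 - t) • z) ∂(stdGaussian d)

/-- Entry `(i, j)` of the Hessian matrix of `f` at `x`. -/
def hessEntry {d : ℕ} (f : EuclideanSpace ℝ (Fin d) → ℝ) (x : EuclideanSpace ℝ (Fin d))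
    (i j : Fin d) : ℝ :=
  pderivI i (pderivI j f) x

/-- The Hessian matrix `∇² f(x)`. -/
def hessMatrix {d : ℕ} (f : EuclideanSpace ℝ (Fin d) → ℝ) (x : EuclideanSpace ℝ (Fin d)) :
    Matrix (Fin d) (Fin d) ℝ :=
  Matrix.of fun i j => hessEntry f x i j

/-- Operator norm `‖M‖_op = sup_{|v| = 1} |M v|` (Euclidean norms) of a `d × d` matrix. -/
def matOpNorm {d : ℕ} (M : Matrix (Fin d) (Fin d) ℝ) : ℝ :=
  sSup { r | ∃ v : EuclideanSpace ℝ (Fin d), ‖v‖ = 1 ∧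
    r = ‖(WithLp.equiv 2 (Fin d → ℝ)).symm (M.mulVec ((WithLp.equiv 2 (Fin d → ℝ)) v))‖ }

/-- The Laplacian `Δ f(x) = ∑ i ∂²f/∂x_i²(x)`. -/
def laplacian {d : ℕ} (f : EuclideanSpace ℝ (Fin d) → ℝ) (x : EuclideanSpace ℝ (Fin d)) : ℝ :=
  ∑ i, hessEntry f x i i

/-- `C` is an `α`-Hölder constant for `h`. -/
def HolderConst {d : ℕ} (α C : ℝ) (h : EuclideanSpace ℝ (Fin d) → ℝ) : Prop :=
  ∀ x y, |h x - h y| ≤ C * dist x y ^ α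

/-- The 1-Wasserstein distance in dual form: sup over 1-Lipschitz test functions. -/
def wasserstein1 {d : ℕ} (μ ν : Measure (EuclideanSpace ℝ (Fin d))) : ℝ :=
  sSup { r | ∃ h : EuclideanSpace ℝ (Fin d) → ℝ, LipschitzWith 1 h ∧
    r = (∫ x, h x ∂μ) - ∫ x, h x ∂ν }

/-- The `α`-Wasserstein distance: sup over continuous `h` with `[h]_α ≤ 1`. -/
def wassersteinHolder {d : ℕ} (α : ℝ) (μ ν : Measure (EuclideanSpace ℝ (Fin d))) : ℝ :=
  sSup { r | ∃ h : EuclideanSpace ℝ (Fin d) → ℝ, Continuous h ∧ HolderConst α 1 h ∧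
    r = (∫ x, h x ∂μ) - ∫ x, h x ∂ν }

/-- The constant `C₁(α, d)`. -/
def C1 (α : ℝ) (d : ℕ) : ℝ :=
  2 ^ (α / 2 + 1) * ((α + 2 * d) / (α * d)) * Real.Gamma ((α + d) / 2) / Real.Gamma (d / 2)

/-- The constant `C₂(α, d)`. -/
def C2 (α : ℝ) (d : ℕ) : ℝ :=
  if α = 1 then 2 * Real.sqrt (2 / π) * Real.sqrt d
  else 2 ^ (α / 2 + 1) * (α + 2 * d) * Real.Gamma ((α + d) / 2) / (α * Real.Gamma (d / 2))

end

section GaussianMeasure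

variable {d : ℕ}

theorem stdGaussian_eq_stdGaussian_euclideanSpace (d : ℕ) :
    stdGaussian d = ProbabilityTheory.stdGaussian (EuclideanSpace ℝ (Fin d)) :=
  map_pi_eq_stdGaussian

instance isGaussian_stdGaussian_fin (d : ℕ) : IsGaussian (stdGaussian d) := by
  rw [stdGaussian_eq_stdGaussian_euclideanSpace]
  infer_instance

theorem integrable_exp_neg_norm_sq_div_two :
    Integrable fun z : EuclideanSpace ℝ (Fin d) => exp (-‖z‖ ^ 2 / 2) := by
  have := (GaussianFourier.integrable_cexp_neg_mul_sq_norm_add (V := EuclideanSpace ℝ (Fin d))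
    (b := 1 / 2) (by norm_num) 0 0).re
  refine this.congr (ae_of_all _ fun z => ?_)
  simp only [zero_mul, add_zero]
  rw [show -(1 / 2 : ℂ) * (‖z‖ : ℂ) ^ 2 = ((-‖z‖ ^ 2 / 2 : ℝ) : ℂ) by push_cast; ring,
    ← Complex.ofReal_exp]
  rfl

theorem integral_exp_neg_norm_sq_div_two_pos :
    0 < ∫ z : EuclideanSpace ℝ (Fin d), exp (-‖z‖ ^ 2 / 2) :=
  integral_exp_pos integrable_exp_neg_norm_sq_div_two

/-- The standard Gaussian measure has the normalised density `exp (-‖z‖² / 2)`. -/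
theorem stdGaussian_eq_withDensity (d : ℕ) :
    stdGaussian d = (volume : Measure (EuclideanSpace ℝ (Fin d))).withDensity fun z =>
      ENNReal.ofReal ((∫ w : EuclideanSpace ℝ (Fin d), exp (-‖w‖ ^ 2 / 2))⁻¹ *
        exp (-‖z‖ ^ 2 / 2)) := by
  set κ := ∫ w : EuclideanSpace ℝ (Fin d), exp (-‖w‖ ^ 2 / 2) with hκ
  have hκ0 : 0 < κ := integral_exp_neg_norm_sq_div_two_pos
  have hint : Integrable fun z : EuclideanSpace ℝ (Fin d) => κ⁻¹ * exp (-‖z‖ ^ 2 / 2) :=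
    integrable_exp_neg_norm_sq_div_two.const_mul _
  have hfin : IsFiniteMeasure ((volume : Measure (EuclideanSpace ℝ (Fin d))).withDensity
      fun z => ENNReal.ofReal (κ⁻¹ * exp (-‖z‖ ^ 2 / 2))) :=
    isFiniteMeasure_withDensity_ofReal hint.2
  refine Measure.ext_of_charFun ?_
  funext t
  rw [stdGaussian_eq_stdGaussian_euclideanSpace, charFun_stdGaussian, charFun_apply,
    integral_withDensity_eq_integral_toReal_smul (by fun_prop)
      (ae_of_all _ fun _ => ENNReal.ofReal_lt_top)]
  have h1 := GaussianFourier.integral_cexp_neg_mul_sq_norm_add (V := EuclideanSpace ℝ (Fin d))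
    (b := 1 / 2) (by norm_num) Complex.I t
  have h0 := GaussianFourier.integral_cexp_neg_mul_sq_norm_add (V := EuclideanSpace ℝ (Fin d))
    (b := 1 / 2) (by norm_num) 0 t
  have hκc : (κ : ℂ) = (π / (1 / 2 : ℂ)) ^ (Module.finrank ℝ (EuclideanSpace ℝ (Fin d)) / 2 : ℂ) := by
    simp only [zero_mul, add_zero, ne_eq, OfNat.ofNat_ne_zero, not_false_eq_true, zero_pow,
      zero_div, Complex.exp_zero, mul_one] at h0
    rw [← h0, hκ, ← integral_complex_ofReal]
    congr with z
    push_cast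
    congr 1
    ring
  rw [← hκc] at h1
  have h2 : ∀ z : EuclideanSpace ℝ (Fin d),
      (ENNReal.ofReal (κ⁻¹ * exp (-‖z‖ ^ 2 / 2))).toReal • Complex.exp (inner ℝ z t * Complex.I)
      = (κ : ℂ)⁻¹ * Complex.exp (-(1 / 2) * (‖z‖ : ℂ) ^ 2 + Complex.I * (inner ℝ t z : ℝ)) := by
    intro z
    rw [ENNReal.toReal_ofReal (by positivity), Complex.real_smul, Complex.exp_add]
    push_cast
    rw [real_inner_comm, mul_assoc]
    congr 3
    · ring
    · ring
  simp_rw [h2]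
  rw [integral_const_mul, h1, ← mul_assoc, inv_mul_cancel₀ (by exact_mod_cast hκ0.ne'), one_mul]
  congr 1
  simp only [Complex.I_sq]
  ring

theorem integral_stdGaussian {F : Type*} [NormedAddCommGroup F] [NormedSpace ℝ F]
    (G : EuclideanSpace ℝ (Fin d) → F) :
    ∫ z, G z ∂(stdGaussian d) =
      (∫ z : EuclideanSpace ℝ (Fin d), exp (-‖z‖ ^ 2 / 2))⁻¹ • ∫ z, exp (-‖z‖ ^ 2 / 2) • G z := by
  have hκ0 := integral_exp_neg_norm_sq_div_two_pos (d := d)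
  rw [stdGaussian_eq_withDensity, integral_withDensity_eq_integral_toReal_smul (by fun_prop)
      (ae_of_all _ fun _ => ENNReal.ofReal_lt_top), ← integral_smul]
  congr with z
  rw [ENNReal.toReal_ofReal (by positivity), smul_smul]

/-- Cameron–Martin formula for a deterministic shift. -/
theorem integral_stdGaussian_comp_add (G : EuclideanSpace ℝ (Fin d) → ℝ)
    (u : EuclideanSpace ℝ (Fin d)) :
    ∫ z, G (z + u) ∂(stdGaussian d) =
      ∫ z, G z * exp (inner ℝ u z - ‖u‖ ^ 2 / 2) ∂(stdGaussian d) := by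
  rw [integral_stdGaussian, integral_stdGaussian,
    ← integral_add_right_eq_self (fun z : EuclideanSpace ℝ (Fin d) => exp (-‖z‖ ^ 2 / 2) •
      (G z * exp (inner ℝ u z - ‖u‖ ^ 2 / 2))) u]
  congr 2 with z
  simp only [smul_eq_mul]
  rw [mul_comm (G _), ← mul_assoc, ← exp_add]
  congr 2
  rw [norm_add_sq_real, inner_add_right, real_inner_self_eq_norm_sq, real_inner_comm u z]
  ring

theorem integrable_exp_mul_norm_stdGaussian (c : ℝ) :
    Integrable (fun z => exp (c * ‖z‖)) (stdGaussian d) := by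
  obtain ⟨K, hK, hint⟩ := IsGaussian.exists_integrable_exp_sq (stdGaussian d)
  refine (hint.const_mul (exp (c ^ 2 / (4 * K)))).mono' (by fun_prop) (ae_of_all _ fun z => ?_)
  rw [norm_of_nonneg (exp_pos _).le, ← exp_add, exp_le_exp]
  have : 0 ≤ (c - 2 * K * ‖z‖) ^ 2 / (4 * K) := by positivity
  have h2 : (c - 2 * K * ‖z‖) ^ 2 / (4 * K) = c ^ 2 / (4 * K) + K * ‖z‖ ^ 2 - c * ‖z‖ := by
    field_simp
    ring
  linarith

theorem integrable_stdGaussian_of_norm_le {F : Type*} [NormedAddCommGroup F]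
    {G : EuclideanSpace ℝ (Fin d) → F} (hG : AEStronglyMeasurable G (stdGaussian d)) {A c : ℝ}
    (h : ∀ z, ‖G z‖ ≤ A * exp (c * ‖z‖)) : Integrable G (stdGaussian d) :=
  ((integrable_exp_mul_norm_stdGaussian c).const_mul A).mono' hG (ae_of_all _ h)

theorem abs_add_inner_sub_le_exp (c : ℝ) (w z : EuclideanSpace ℝ (Fin d))
    {u : EuclideanSpace ℝ (Fin d)} (hu : ‖u‖ ≤ 1) :
    |c + inner ℝ w (z - u)| ≤ (|c| + ‖w‖) * exp ‖z‖ := by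
  have h1 : |inner ℝ w (z - u)| ≤ ‖w‖ * (1 + ‖z‖) :=
    (abs_real_inner_le_norm _ _).trans (by
      have := norm_sub_le z u
      gcongr; linarith)
  have h2 := abs_add_le c (inner ℝ w (z - u))
  have h3 : |c| * 1 ≤ |c| * exp ‖z‖ := by
    gcongr; exact one_le_exp (norm_nonneg _)
  have h4 : ‖w‖ * (1 + ‖z‖) ≤ ‖w‖ * exp ‖z‖ := by
    gcongr; linarith [add_one_le_exp ‖z‖]
  linarith

theorem norm_smul_sub_le_exp (c : ℝ) (w z : EuclideanSpace ℝ (Fin d))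
    {u : EuclideanSpace ℝ (Fin d)} (hu : ‖u‖ ≤ 1) :
    ‖(c + inner ℝ w (z - u)) • (z - u) - w‖ ≤ (|c| + 2 * ‖w‖) * exp (2 * ‖z‖) := by
  have h1 : 1 + ‖z‖ ≤ exp ‖z‖ := by linarith [add_one_le_exp ‖z‖]
  have h2 : 1 ≤ exp (2 * ‖z‖) := one_le_exp (by positivity)
  calc ‖(c + inner ℝ w (z - u)) • (z - u) - w‖
      ≤ ((|c| + ‖w‖) * exp ‖z‖) * exp ‖z‖ + ‖w‖ * exp (2 * ‖z‖) := by
        refine (norm_sub_le _ _).trans ?_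
        rw [norm_smul, norm_eq_abs]
        gcongr
        · exact abs_add_inner_sub_le_exp c w z hu
        · linarith [norm_sub_le z u]
        · nlinarith [norm_nonneg w]
    _ = _ := by rw [two_mul ‖z‖, exp_add]; ring

theorem integrable_mul_affine {G : EuclideanSpace ℝ (Fin d) → ℝ} (hGc : Continuous G) {A : ℝ}
    (hG : ∀ z, |G z| ≤ A * exp ‖z‖) (c : ℝ) (w : EuclideanSpace ℝ (Fin d)) :
    Integrable (fun z => G z * (c + inner ℝ w z)) (stdGaussian d) := by
  refine integrable_stdGaussian_of_norm_le (A := A * (|c| + ‖w‖)) (c := 2) (by fun_prop) fun z => ?_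
  have h1 := abs_add_inner_sub_le_exp c w z (u := 0) (by simp)
  rw [sub_zero] at h1
  rw [norm_mul, norm_eq_abs, norm_eq_abs]
  calc |G z| * |c + inner ℝ w z| ≤ (A * exp ‖z‖) * ((|c| + ‖w‖) * exp ‖z‖) :=
        mul_le_mul (hG z) h1 (abs_nonneg _) ((abs_nonneg _).trans (hG z))
    _ = _ := by rw [two_mul, exp_add]; ring

theorem integrable_smul_affine_smul_sub {G : EuclideanSpace ℝ (Fin d) → ℝ} (hGc : Continuous G)
    {A : ℝ} (hG : ∀ z, |G z| ≤ A * exp ‖z‖) (c : ℝ) (w : EuclideanSpace ℝ (Fin d)) :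
    Integrable (fun z => G z • ((c + inner ℝ w z) • z - w)) (stdGaussian d) := by
  refine integrable_stdGaussian_of_norm_le (A := A * (|c| + 2 * ‖w‖)) (c := 3) (by fun_prop)
    fun z => ?_
  have h1 := norm_smul_sub_le_exp c w z (u := 0) (by simp)
  rw [sub_zero] at h1
  rw [norm_smul, norm_eq_abs]
  calc |G z| * ‖(c + inner ℝ w z) • z - w‖
      ≤ (A * exp ‖z‖) * ((|c| + 2 * ‖w‖) * exp (2 * ‖z‖)) :=
        mul_le_mul (hG z) h1 (norm_nonneg _) ((abs_nonneg _).trans (hG z))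
    _ = _ := by rw [show 3 * ‖z‖ = ‖z‖ + 2 * ‖z‖ by ring, exp_add]; ring

/-- Integration by parts: differentiating the shift of a function of moderate growth, against an
affine weight. -/
theorem hasFDerivAt_integral_shift {G : EuclideanSpace ℝ (Fin d) → ℝ} (hGc : Continuous G) {A : ℝ}
    (hG : ∀ z, |G z| ≤ A * exp ‖z‖) (c : ℝ) (w : EuclideanSpace ℝ (Fin d)) :
    HasFDerivAt (fun u => ∫ z, G (z + u) * (c + inner ℝ w z) ∂(stdGaussian d))
      (innerSL ℝ (∫ z, G z • ((c + inner ℝ w z) • z - w) ∂(stdGaussian d))) 0 := by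
  have key : ∀ u, ∫ z, G (z + u) * (c + inner ℝ w z) ∂(stdGaussian d) =
      ∫ z, G z * (c + inner ℝ w (z - u)) * exp (inner ℝ u z - ‖u‖ ^ 2 / 2) ∂(stdGaussian d) := by
    intro u
    rw [← integral_stdGaussian_comp_add (fun z => G z * (c + inner ℝ w (z - u)))]
    simp
  simp_rw [key]
  have hexp : ∀ z u : EuclideanSpace ℝ (Fin d), ‖u‖ ≤ 1 →
      exp (inner ℝ u z - ‖u‖ ^ 2 / 2) ≤ exp ‖z‖ := by
    intro z u hu
    rw [exp_le_exp]
    have h1 := real_inner_le_norm u z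
    have h2 : ‖u‖ * ‖z‖ ≤ 1 * ‖z‖ := by gcongr
    nlinarith [sq_nonneg ‖u‖]
  have hmain := hasFDerivAt_integral_of_dominated_of_fderiv_le (𝕜 := ℝ) (μ := stdGaussian d)
    (F := fun u z => G z * (c + inner ℝ w (z - u)) * exp (inner ℝ u z - ‖u‖ ^ 2 / 2))
    (F' := fun u z => innerSL ℝ ((G z * exp (inner ℝ u z - ‖u‖ ^ 2 / 2)) •
      ((c + inner ℝ w (z - u)) • (z - u) - w)))
    (bound := fun z => A * (|c| + 2 * ‖w‖) * exp (4 * ‖z‖))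
    (s := Metric.closedBall 0 1) (x₀ := 0) (Metric.closedBall_mem_nhds 0 one_pos)
    (Eventually.of_forall fun u => by fun_prop) ?_ ?_ ?_
    ((integrable_exp_mul_norm_stdGaussian 4).const_mul _) ?_
  · refine hmain.congr_fderiv ?_
    simp only [inner_zero_left, norm_zero, ne_eq, OfNat.ofNat_ne_zero, not_false_eq_true, zero_pow,
      zero_div, sub_zero, exp_zero, mul_one]
    exact ContinuousLinearMap.integral_comp_comm (innerSL ℝ)
      (integrable_smul_affine_smul_sub hGc hG c w)
  · refine (integrable_mul_affine hGc hG c w).congr (ae_of_all _ fun z => ?_)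
    simp
  · exact ((innerSL ℝ).continuous.comp (by fun_prop)).aestronglyMeasurable
  · refine ae_of_all _ fun z u hu => ?_
    rw [mem_closedBall_zero_iff] at hu
    rw [innerSL_apply_norm, norm_smul, norm_mul, norm_eq_abs, norm_of_nonneg (exp_pos _).le]
    have hAz := (abs_nonneg _).trans (hG z)
    calc |G z| * exp (inner ℝ u z - ‖u‖ ^ 2 / 2) * ‖(c + inner ℝ w (z - u)) • (z - u) - w‖
        ≤ (A * exp ‖z‖) * exp ‖z‖ * ((|c| + 2 * ‖w‖) * exp (2 * ‖z‖)) :=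
          mul_le_mul (mul_le_mul (hG z) (hexp z u hu) (exp_pos _).le hAz)
            (norm_smul_sub_le_exp c w z hu) (norm_nonneg _) (mul_nonneg hAz (exp_pos _).le)
      _ = _ := by
          rw [show 4 * ‖z‖ = ‖z‖ + ‖z‖ + 2 * ‖z‖ by ring, exp_add, exp_add]; ring
  · refine ae_of_all _ fun z u _ => ?_
    have h1 : HasFDerivAt (fun u : EuclideanSpace ℝ (Fin d) => c + inner ℝ w (z - u))
        (-innerSL ℝ w) u := by
      have := (((innerSL ℝ w).hasFDerivAt (x := z - u)).comp u
        ((hasFDerivAt_id u).const_sub z)).const_add c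
      refine this.congr_fderiv ?_
      ext v
      simp
    have h2 : HasFDerivAt (fun u : EuclideanSpace ℝ (Fin d) => inner ℝ u z - ‖u‖ ^ 2 / 2)
        (innerSL ℝ (z - u)) u := by
      have h3 := (innerSL ℝ z).hasFDerivAt (x := u)
      have h4 := ((hasStrictFDerivAt_norm_sq u).hasFDerivAt).const_mul (1 / 2 : ℝ)
      have h5 := h3.sub h4
      refine (h5.congr_fderiv ?_).congr_of_eventuallyEq (Eventually.of_forall fun v => ?_)
      · ext v
        simp
      · simp [real_inner_comm]
        ring
    refine ((h1.const_mul (G z)).mul h2.exp).congr_fderiv ?_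
    ext v
    simp
    ring

end GaussianMeasure

section Smoothing

variable {d : ℕ}

theorem HolderConst.continuous {α C : ℝ} {h : EuclideanSpace ℝ (Fin d) → ℝ} (hα : 0 < α)
    (hC : HolderConst α C h) : Continuous h := by
  rw [continuous_iff_continuousAt]
  intro x
  rw [ContinuousAt, tendsto_iff_dist_tendsto_zero]
  have h1 : Tendsto (fun y => C * dist y x ^ α) (nhds x) (nhds 0) := by
    have : Continuous fun y => C * dist y x ^ α := by
      refine continuous_const.mul (Continuous.rpow_const (by fun_prop) fun _ => Or.inr hα.le)
    have h2 := this.tendsto x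
    rwa [dist_self, zero_rpow hα.ne', mul_zero] at h2
  exact squeeze_zero (fun _ => dist_nonneg) (fun y => hC y x) h1

theorem HolderConst.abs_le_exp {α C : ℝ} {h : EuclideanSpace ℝ (Fin d) → ℝ} (hα : 0 < α)
    (hα1 : α ≤ 1) (hC0 : 0 ≤ C) (hC : HolderConst α C h) (m : EuclideanSpace ℝ (Fin d))
    {σ : ℝ} (hσ : |σ| ≤ 1) :
    ∀ z, |h (m + σ • z)| ≤ (|h m| + C) * exp ‖z‖ := by
  intro z
  have h1 := hC (m + σ • z) m
  have h2 : dist (m + σ • z) m ≤ ‖z‖ := by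
    rw [dist_eq_norm, add_sub_cancel_left, norm_smul, norm_eq_abs]
    exact mul_le_of_le_one_left (norm_nonneg _) hσ
  have h3 : dist (m + σ • z) m ^ α ≤ exp ‖z‖ := by
    calc dist (m + σ • z) m ^ α ≤ exp ‖z‖ ^ α := by
          gcongr
          linarith [add_one_le_exp ‖z‖]
      _ ≤ exp ‖z‖ ^ (1 : ℝ) := rpow_le_rpow_of_exponent_le (one_le_exp (norm_nonneg _)) hα1
      _ = _ := rpow_one _
  have h4 : |h m| * 1 ≤ |h m| * exp ‖z‖ := by
    gcongr; exact one_le_exp (norm_nonneg _)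
  have h5 : C * dist (m + σ • z) m ^ α ≤ C * exp ‖z‖ := by gcongr
  have h6 := abs_sub_abs_le_abs_sub (h (m + σ • z)) (h m)
  linarith

/-- Second-order Hermite identity: the Gaussian mean of the integration-by-parts weight of an affine
function vanishes. -/
theorem integral_affine_smul_sub (c : ℝ) (w : EuclideanSpace ℝ (Fin d)) :
    ∫ z, ((c + inner ℝ w z) • z - w) ∂(stdGaussian d) = 0 := by
  have h1 := hasFDerivAt_integral_shift (G := fun _ : EuclideanSpace ℝ (Fin d) => (1 : ℝ))
    continuous_const (A := 1) (by simp) c w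
  have h2 := h1.unique (hasFDerivAt_const _ _)
  simp only [one_smul] at h2
  rw [← norm_eq_zero, ← innerSL_apply_norm (𝕜 := ℝ), h2, norm_zero]

/-- `E[h(√t x + √(1-t) Z) (c + ⟨w, Z⟩)]`. -/
noncomputable def mehlerAffine (h : EuclideanSpace ℝ (Fin d) → ℝ) (c : ℝ)
    (w : EuclideanSpace ℝ (Fin d)) (t : ℝ) (x : EuclideanSpace ℝ (Fin d)) : ℝ :=
  ∫ z, h (√t • x + √(1 - t) • z) * (c + inner ℝ w z) ∂(stdGaussian d)

/-- `E[h(√t x + √(1-t) Z) ((c + ⟨w, Z⟩) Z - w)]`, which is the gradient of `mehlerAffine` up to a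
scalar. -/
noncomputable def mehlerGradient (h : EuclideanSpace ℝ (Fin d) → ℝ) (c : ℝ)
    (w : EuclideanSpace ℝ (Fin d)) (t : ℝ) (x : EuclideanSpace ℝ (Fin d)) :
    EuclideanSpace ℝ (Fin d) :=
  ∫ z, h (√t • x + √(1 - t) • z) • ((c + inner ℝ w z) • z - w) ∂(stdGaussian d)

theorem abs_sqrt_one_sub_le_one {t : ℝ} (ht : t ∈ Ioo (0 : ℝ) 1) : |√(1 - t)| ≤ 1 := by
  rw [abs_of_nonneg (sqrt_nonneg _)]
  exact sqrt_le_one.2 (by linarith [ht.1])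

variable {α C : ℝ} {h : EuclideanSpace ℝ (Fin d) → ℝ}

theorem hasFDerivAt_mehlerAffine (hα : 0 < α) (hα1 : α ≤ 1) (hC0 : 0 ≤ C) (hC : HolderConst α C h)
    (c : ℝ) (w : EuclideanSpace ℝ (Fin d)) {t : ℝ} (ht : t ∈ Ioo (0 : ℝ) 1)
    (x : EuclideanSpace ℝ (Fin d)) :
    HasFDerivAt (mehlerAffine h c w t)
      (innerSL ℝ ((√t / √(1 - t)) • mehlerGradient h c w t x)) x := by
  have hσ : 0 < √(1 - t) := sqrt_pos.2 (by linarith [ht.2])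
  have hh := hC.continuous hα
  have h1 := hasFDerivAt_integral_shift (G := fun z => h (√t • x + √(1 - t) • z)) (by fun_prop)
    (hC.abs_le_exp hα hα1 hC0 (√t • x) (abs_sqrt_one_sub_le_one ht)) c w
  have h2 : HasFDerivAt (fun y : EuclideanSpace ℝ (Fin d) => (√t / √(1 - t)) • (y - x))
      ((√t / √(1 - t)) • ContinuousLinearMap.id ℝ (EuclideanSpace ℝ (Fin d))) x :=
    ((hasFDerivAt_id x).sub_const x).const_smul (√t / √(1 - t))
  have h3 := HasFDerivAt.comp x (by simpa using h1) h2
  refine (h3.congr_fderiv ?_).congr_of_eventuallyEq (Eventually.of_forall fun y => ?_)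
  · ext v
    simp [mehlerGradient]
  · simp only [mehlerAffine, Function.comp_apply]
    congr with z
    congr 2
    rw [smul_smul, mul_div_cancel₀ _ hσ.ne', smul_sub]
    abel

theorem integrable_mehlerAffine (hα : 0 < α) (hα1 : α ≤ 1) (hC0 : 0 ≤ C) (hC : HolderConst α C h)
    (c : ℝ) (w : EuclideanSpace ℝ (Fin d)) {t : ℝ} (ht : t ∈ Ioo (0 : ℝ) 1)
    (x : EuclideanSpace ℝ (Fin d)) :
    Integrable (fun z => h (√t • x + √(1 - t) • z) * (c + inner ℝ w z)) (stdGaussian d) := by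
  have hh := hC.continuous hα
  exact integrable_mul_affine (by fun_prop)
    (hC.abs_le_exp hα hα1 hC0 (√t • x) (abs_sqrt_one_sub_le_one ht)) c w

theorem integrable_mehlerGradient (hα : 0 < α) (hα1 : α ≤ 1) (hC0 : 0 ≤ C) (hC : HolderConst α C h)
    (c : ℝ) (w : EuclideanSpace ℝ (Fin d)) {t : ℝ} (ht : t ∈ Ioo (0 : ℝ) 1)
    (x : EuclideanSpace ℝ (Fin d)) :
    Integrable (fun z => h (√t • x + √(1 - t) • z) • ((c + inner ℝ w z) • z - w))
      (stdGaussian d) := by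
  have hh := hC.continuous hα
  exact integrable_smul_affine_smul_sub (by fun_prop)
    (hC.abs_le_exp hα hα1 hC0 (√t • x) (abs_sqrt_one_sub_le_one ht)) c w

theorem stronglyMeasurable_mehlerAffine (hh : Continuous h) (c : ℝ)
    (w x : EuclideanSpace ℝ (Fin d)) : StronglyMeasurable fun t => mehlerAffine h c w t x := by
  refine StronglyMeasurable.integral_prod_right' (f := fun p : ℝ × EuclideanSpace ℝ (Fin d) =>
    h (√p.1 • x + √(1 - p.1) • p.2) * (c + inner ℝ w p.2)) ?_
  exact Continuous.stronglyMeasurable (by fun_prop)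

theorem stronglyMeasurable_mehlerGradient (hh : Continuous h) (c : ℝ)
    (w x : EuclideanSpace ℝ (Fin d)) : StronglyMeasurable fun t => mehlerGradient h c w t x := by
  refine StronglyMeasurable.integral_prod_right' (f := fun p : ℝ × EuclideanSpace ℝ (Fin d) =>
    h (√p.1 • x + √(1 - p.1) • p.2) • ((c + inner ℝ w p.2) • p.2 - w)) ?_
  exact Continuous.stronglyMeasurable (by fun_prop)

theorem HolderConst.abs_sub_mehler_le (hC : HolderConst α C h) {t : ℝ}
    (x z : EuclideanSpace ℝ (Fin d)) :
    |h (√t • x + √(1 - t) • z) - h (√t • x)| ≤ C * √(1 - t) ^ α * ‖z‖ ^ α := by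
  refine (hC _ _).trans (le_of_eq ?_)
  rw [dist_eq_norm, add_sub_cancel_left, norm_smul, norm_of_nonneg (sqrt_nonneg _),
    mul_rpow (sqrt_nonneg _) (norm_nonneg _), mul_assoc]

theorem integrable_norm_rpow_mul {F : Type*} [NormedAddCommGroup F] {α : ℝ} (hα : 0 ≤ α)
    {g : EuclideanSpace ℝ (Fin d) → F} (hg : Continuous g) {A c : ℝ}
    (hA : ∀ z, ‖g z‖ ≤ A * exp (c * ‖z‖)) :
    Integrable (fun z => ‖z‖ ^ α * ‖g z‖) (stdGaussian d) := by
  refine integrable_stdGaussian_of_norm_le (A := A) (c := α + c) (Continuous.aestronglyMeasurable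
    ((Continuous.rpow_const (by fun_prop) fun _ => Or.inr hα).mul hg.norm)) fun z => ?_
  have h1 : ‖z‖ ^ α ≤ exp (α * ‖z‖) := by
    rw [mul_comm, exp_mul]
    gcongr
    linarith [add_one_le_exp ‖z‖]
  rw [norm_mul, norm_norm, norm_of_nonneg (rpow_nonneg (norm_nonneg _) _)]
  calc ‖z‖ ^ α * ‖g z‖ ≤ exp (α * ‖z‖) * (A * exp (c * ‖z‖)) := by gcongr; exact hA z
    _ = _ := by rw [add_mul, exp_add]; ring

theorem norm_mehlerGradient_le (hα : 0 < α) (hα1 : α ≤ 1) (hC0 : 0 ≤ C) (hC : HolderConst α C h)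
    (c : ℝ) (w : EuclideanSpace ℝ (Fin d)) {t : ℝ} (ht : t ∈ Ioo (0 : ℝ) 1)
    (x : EuclideanSpace ℝ (Fin d)) :
    ‖mehlerGradient h c w t x‖ ≤ C * √(1 - t) ^ α *
      ∫ z, ‖z‖ ^ α * ‖(c + inner ℝ w z) • z - w‖ ∂(stdGaussian d) := by
  have hint := integrable_norm_rpow_mul (d := d) hα.le
    (g := fun z => (c + inner ℝ w z) • z - w) (by fun_prop)
    (fun z => by simpa using norm_smul_sub_le_exp c w z (u := 0) (by simp))
  have h1 : mehlerGradient h c w t x = ∫ z, (h (√t • x + √(1 - t) • z) - h (√t • x)) •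
      ((c + inner ℝ w z) • z - w) ∂(stdGaussian d) := by
    simp_rw [sub_smul]
    rw [integral_sub, integral_smul, integral_affine_smul_sub, smul_zero, sub_zero, mehlerGradient]
    · exact integrable_mehlerGradient hα hα1 hC0 hC c w ht x
    · exact integrable_smul_affine_smul_sub continuous_const
        (fun z => le_mul_of_one_le_right (abs_nonneg _) (one_le_exp (norm_nonneg z))) c w
  rw [h1, ← integral_const_mul]
  refine norm_integral_le_of_norm_le (hint.const_mul _) (ae_of_all _ fun z => ?_)
  rw [norm_smul, norm_eq_abs, ← mul_assoc]
  gcongr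
  exact hC.abs_sub_mehler_le x z

end Smoothing

section TimeIntegral

theorem integrableOn_rpow_Ioo {p : ℝ} (hp : -1 < p) :
    IntegrableOn (fun t : ℝ => t ^ p) (Ioo 0 1) :=
  (intervalIntegral.integrableOn_Ioo_rpow_iff one_pos).2 hp

theorem integrableOn_one_sub_rpow_Ioo {p : ℝ} (hp : -1 < p) :
    IntegrableOn (fun t : ℝ => (1 - t) ^ p) (Ioo 0 1) := by
  have h := (intervalIntegral.intervalIntegrable_rpow' (a := 0) (b := 1) hp).comp_sub_left 1
  simp only [sub_zero, sub_self] at h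
  exact ((intervalIntegrable_iff_integrableOn_Ioo_of_le zero_le_one).1 h.symm)

theorem integral_one_sub_rpow_Ioo {p : ℝ} (hp : -1 < p) :
    ∫ t in Ioo (0 : ℝ) 1, (1 - t) ^ p = 1 / (p + 1) := by
  rw [← integral_Ioc_eq_integral_Ioo, ← intervalIntegral.integral_of_le zero_le_one,
    intervalIntegral.integral_comp_sub_left (fun t => t ^ p) 1, sub_self, sub_zero,
    integral_rpow (Or.inl hp), one_rpow, zero_rpow (by linarith), sub_zero]

variable {d : ℕ} {α C : ℝ} {h : EuclideanSpace ℝ (Fin d) → ℝ}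

theorem integrableOn_smul_mehlerGradient (hα : 0 < α) (hα1 : α ≤ 1) (hC0 : 0 ≤ C)
    (hC : HolderConst α C h) (c : ℝ) (w x : EuclideanSpace ℝ (Fin d)) {k : ℝ → ℝ}
    (hk : Measurable k) (hk1 : IntegrableOn (fun t => k t * √(1 - t) ^ α) (Ioo 0 1)) :
    IntegrableOn (fun t => k t • mehlerGradient h c w t x) (Ioo 0 1) := by
  refine (hk1.norm.mul_const (C * ∫ z, ‖z‖ ^ α * ‖(c + inner ℝ w z) • z - w‖
    ∂(stdGaussian d))).mono' (hk.aestronglyMeasurable.smul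
    (stronglyMeasurable_mehlerGradient (hC.continuous hα) c w x).aestronglyMeasurable)
    (ae_restrict_of_forall_mem measurableSet_Ioo fun t ht => ?_)
  rw [norm_smul, norm_mul, norm_of_nonneg (rpow_nonneg (sqrt_nonneg (1 - t)) α)]
  calc ‖k t‖ * ‖mehlerGradient h c w t x‖ ≤ ‖k t‖ * (C * √(1 - t) ^ α *
        ∫ z, ‖z‖ ^ α * ‖(c + inner ℝ w z) • z - w‖ ∂(stdGaussian d)) := by
        gcongr; exact norm_mehlerGradient_le hα hα1 hC0 hC c w ht x
    _ = _ := by ring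

theorem hasFDerivAt_integral_mehlerAffine (hα : 0 < α) (hα1 : α ≤ 1) (hC0 : 0 ≤ C)
    (hC : HolderConst α C h) (c : ℝ) (w x : EuclideanSpace ℝ (Fin d)) {k : ℝ → ℝ}
    (hk : Measurable k)
    (hk0 : IntegrableOn (fun t => k t * mehlerAffine h c w t x) (Ioo 0 1))
    (hk1 : IntegrableOn (fun t => k t * (√t / √(1 - t)) * √(1 - t) ^ α) (Ioo 0 1)) :
    HasFDerivAt (fun x => ∫ t in Ioo (0 : ℝ) 1, k t * mehlerAffine h c w t x)
      (innerSL ℝ (∫ t in Ioo (0 : ℝ) 1, (k t * (√t / √(1 - t))) • mehlerGradient h c w t x)) x := by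
  have hh := hC.continuous hα
  have hkm : Measurable fun t => k t * (√t / √(1 - t)) := by fun_prop
  have hmain := hasFDerivAt_integral_of_dominated_of_fderiv_le (𝕜 := ℝ)
    (μ := volume.restrict (Ioo (0 : ℝ) 1))
    (F := fun x t => k t * mehlerAffine h c w t x)
    (F' := fun x t => innerSL ℝ ((k t * (√t / √(1 - t))) • mehlerGradient h c w t x))
    (bound := fun t => ‖k t * (√t / √(1 - t)) * √(1 - t) ^ α‖ *
      (C * ∫ z, ‖z‖ ^ α * ‖(c + inner ℝ w z) • z - w‖ ∂(stdGaussian d)))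
    (s := univ) (x₀ := x) univ_mem
    (Eventually.of_forall fun y => hk.aestronglyMeasurable.mul
      (stronglyMeasurable_mehlerAffine hh c w y).aestronglyMeasurable) hk0
    ((innerSL ℝ).continuous.comp_aestronglyMeasurable (hkm.aestronglyMeasurable.smul
      (stronglyMeasurable_mehlerGradient hh c w x).aestronglyMeasurable))
    (ae_restrict_of_forall_mem measurableSet_Ioo fun t ht y _ => ?_) (hk1.norm.mul_const _)
    (ae_restrict_of_forall_mem measurableSet_Ioo fun t ht y _ => ?_)
  · refine hmain.congr_fderiv ?_
    exact ContinuousLinearMap.integral_comp_comm (innerSL ℝ)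
      (integrableOn_smul_mehlerGradient hα hα1 hC0 hC c w x hkm hk1)
  · rw [innerSL_apply_norm, norm_smul, norm_mul _ (√(1 - t) ^ α),
      norm_of_nonneg (rpow_nonneg (sqrt_nonneg (1 - t)) α)]
    calc ‖k t * (√t / √(1 - t))‖ * ‖mehlerGradient h c w t y‖
        ≤ ‖k t * (√t / √(1 - t))‖ * (C * √(1 - t) ^ α *
          ∫ z, ‖z‖ ^ α * ‖(c + inner ℝ w z) • z - w‖ ∂(stdGaussian d)) := by
          gcongr; exact norm_mehlerGradient_le hα hα1 hC0 hC c w ht y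
      _ = _ := by ring
  · refine ((hasFDerivAt_mehlerAffine hα hα1 hC0 hC c w ht y).const_mul (k t)).congr_fderiv ?_
    simp [smul_smul]

end TimeIntegral

section SteinSolution

variable {d : ℕ} {α C : ℝ} {h : EuclideanSpace ℝ (Fin d) → ℝ}

theorem HolderConst.hbar (hC : HolderConst α C h) : HolderConst α C (hbar d h) := fun x y => by
  simpa [_root_.hbar] using hC x y

theorem HolderConst.integrable (hα : 0 < α) (hα1 : α ≤ 1) (hC0 : 0 ≤ C)
    (hC : HolderConst α C h) : Integrable h (stdGaussian d) :=
  integrable_stdGaussian_of_norm_le (hC.continuous hα).aestronglyMeasurable (c := 1) fun z => by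
    simpa using hC.abs_le_exp hα hα1 hC0 0 (σ := 1) (by simp) z

/-- Near `t = 0` the centred semigroup is of order `t ^ (α / 2)`. -/
theorem abs_mehlerAffine_hbar_le (hα : 0 < α) (hα1 : α ≤ 1) (hC0 : 0 ≤ C)
    (hC : HolderConst α C h) {t : ℝ} (ht : t ∈ Ioo (0 : ℝ) 1) (x : EuclideanSpace ℝ (Fin d)) :
    |mehlerAffine (hbar d h) 1 0 t x| ≤
      √t ^ α * ∫ z, C * ((1 + ‖x‖) * exp (1 * ‖z‖)) ∂(stdGaussian d) := by
  have h1 : mehlerAffine (hbar d h) 1 0 t x =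
      ∫ z, (h (√t • x + √(1 - t) • z) - h z) ∂(stdGaussian d) := by
    have hi := integrable_mehlerAffine hα hα1 hC0 hC 1 0 ht x
    simp only [inner_zero_left, add_zero, mul_one] at hi
    rw [integral_sub hi (hC.integrable hα hα1 hC0)]
    simp only [mehlerAffine, hbar, inner_zero_left, add_zero, mul_one]
    rw [integral_sub hi (integrable_const _)]
    simp
  rw [h1, ← integral_const_mul, ← norm_eq_abs]
  refine norm_integral_le_of_norm_le
    ((((integrable_exp_mul_norm_stdGaussian 1).const_mul (1 + ‖x‖)).const_mul C).const_mul _)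
    (ae_of_all _ fun z => ?_)
  rw [norm_eq_abs]
  refine (hC _ _).trans ?_
  have hs0 := sqrt_nonneg t
  have hs1 : 1 - √(1 - t) ≤ √t := by
    have := sqrt_nonneg (1 - t)
    have h2 := sq_sqrt ht.1.le
    have h3 := sq_sqrt (show 0 ≤ 1 - t by linarith [ht.2])
    nlinarith
  have hs2 : √(1 - t) ≤ 1 := (le_abs_self _).trans (abs_sqrt_one_sub_le_one ht)
  have h2 : dist (√t • x + √(1 - t) • z) z ≤ √t * ((1 + ‖x‖) * exp (1 * ‖z‖)) := by
    have h3 : √t • x + √(1 - t) • z - z = √t • x - (1 - √(1 - t)) • z := by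
      rw [sub_smul, one_smul]; abel
    rw [dist_eq_norm, h3]
    refine (norm_sub_le _ _).trans ?_
    rw [norm_smul, norm_smul, norm_of_nonneg hs0, norm_of_nonneg (by linarith)]
    have h4 : 1 + ‖z‖ ≤ exp (1 * ‖z‖) := by linarith [add_one_le_exp (1 * ‖z‖)]
    calc √t * ‖x‖ + (1 - √(1 - t)) * ‖z‖ ≤ √t * ‖x‖ + √t * ‖z‖ := by gcongr
      _ = √t * (‖x‖ + ‖z‖) := by ring
      _ ≤ √t * ((1 + ‖x‖) * exp (1 * ‖z‖)) := by
        gcongr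
        nlinarith [norm_nonneg x, norm_nonneg z]
  have h5 : 1 ≤ (1 + ‖x‖) * exp (1 * ‖z‖) :=
    one_le_mul_of_one_le_of_one_le (by linarith [norm_nonneg x]) (one_le_exp (by positivity))
  calc C * dist (√t • x + √(1 - t) • z) z ^ α
      ≤ C * (√t * ((1 + ‖x‖) * exp (1 * ‖z‖))) ^ α := by gcongr
    _ = √t ^ α * (C * ((1 + ‖x‖) * exp (1 * ‖z‖)) ^ α) := by
        rw [mul_rpow hs0 (by positivity)]; ring
    _ ≤ √t ^ α * (C * ((1 + ‖x‖) * exp (1 * ‖z‖))) := by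
        gcongr
        exact (rpow_le_rpow_of_exponent_le h5 hα1).trans_eq (rpow_one _)

theorem steinSol_eq (h : EuclideanSpace ℝ (Fin d) → ℝ) (x : EuclideanSpace ℝ (Fin d)) :
    steinSol d h x =
      -∫ t in Ioo (0 : ℝ) 1, 1 / (2 * t) * mehlerAffine (hbar d h) 1 0 t x := by
  simp [steinSol, mehlerAffine]

theorem integrableOn_mehlerAffine_hbar (hα : 0 < α) (hα1 : α ≤ 1) (hC0 : 0 ≤ C)
    (hC : HolderConst α C h) (x : EuclideanSpace ℝ (Fin d)) :
    IntegrableOn (fun t => 1 / (2 * t) * mehlerAffine (hbar d h) 1 0 t x) (Ioo 0 1) := by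
  refine ((integrableOn_rpow_Ioo (p := α / 2 - 1) (by linarith)).mul_const
    (1 / 2 * ∫ z, C * ((1 + ‖x‖) * exp (1 * ‖z‖)) ∂(stdGaussian d))).mono'
    (AEStronglyMeasurable.mul (Measurable.aestronglyMeasurable (by fun_prop))
      (stronglyMeasurable_mehlerAffine (hC.hbar.continuous hα) 1 0 x).aestronglyMeasurable)
    (ae_restrict_of_forall_mem measurableSet_Ioo fun t ht => ?_)
  have ht0 := ht.1
  have h1 : √t ^ α = t ^ (α / 2 - 1) * t := by
    rw [sqrt_eq_rpow, ← rpow_mul ht0.le, ← rpow_add_one ht0.ne']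
    congr 1; ring
  have h2 := abs_mehlerAffine_hbar_le hα hα1 hC0 hC ht x
  rw [norm_mul, norm_of_nonneg (by positivity), norm_eq_abs]
  calc 1 / (2 * t) * |mehlerAffine (hbar d h) 1 0 t x|
      ≤ 1 / (2 * t) * (√t ^ α * ∫ z, C * ((1 + ‖x‖) * exp (1 * ‖z‖)) ∂(stdGaussian d)) := by
        gcongr
    _ = _ := by rw [h1]; field_simp

theorem integrableOn_first_order_weight (hα : 0 < α) :
    IntegrableOn (fun t : ℝ => 1 / (2 * t) * (√t / √(1 - t)) * √(1 - t) ^ α) (Ioo 0 1) := by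
  refine ((integrableOn_rpow_Ioo (p := -(1 / 2)) (by norm_num)).add
    (integrableOn_one_sub_rpow_Ioo (p := -(1 / 2)) (by norm_num))).mono'
    (Measurable.aestronglyMeasurable (by fun_prop))
    (ae_restrict_of_forall_mem measurableSet_Ioo fun t ht => ?_)
  have ht0 := ht.1
  have ht1 : 0 < 1 - t := by linarith [ht.2]
  rw [norm_of_nonneg (by positivity), Pi.add_apply, rpow_neg ht0.le, rpow_neg ht1.le,
    ← sqrt_eq_rpow, ← sqrt_eq_rpow]
  have ha := sqrt_pos.2 ht0
  have hb := sqrt_pos.2 ht1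
  have hb1 : √(1 - t) ≤ 1 := (le_abs_self _).trans (abs_sqrt_one_sub_le_one ht)
  have hsq := sq_sqrt ht0.le
  have hsq' := sq_sqrt ht1.le
  have h1 : √(1 - t) ^ α ≤ 1 := rpow_le_one hb.le hb1 hα.le
  have h2 : 1 ≤ √t + √(1 - t) := by nlinarith
  calc 1 / (2 * t) * (√t / √(1 - t)) * √(1 - t) ^ α
      ≤ 1 / (2 * t) * (√t / √(1 - t)) * 1 := by gcongr
    _ = 1 / (2 * √t ^ 2) * (√t / √(1 - t)) := by rw [hsq, mul_one]
    _ = 1 / (2 * (√t * √(1 - t))) := by field_simp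
    _ ≤ (√t + √(1 - t)) / (√t * √(1 - t)) := by
        rw [div_le_div_iff₀ (by positivity) (by positivity)]
        nlinarith [mul_pos ha hb]
    _ = _ := by field_simp; ring

theorem integrableOn_second_order_weight (hα : 0 < α) :
    IntegrableOn (fun t : ℝ => 1 / (2 * t) * (√t / √(1 - t)) * (√t / √(1 - t)) * √(1 - t) ^ α)
      (Ioo 0 1) := by
  have h0 : IntegrableOn (fun t : ℝ => 1 / 2 * (1 - t) ^ (α / 2 - 1)) (Ioo 0 1) :=
    (integrableOn_one_sub_rpow_Ioo (by linarith)).const_mul _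
  refine h0.congr_fun (fun t ht => ?_) measurableSet_Ioo
  have ht0 := ht.1
  have ht1 : 0 < 1 - t := by linarith [ht.2]
  have h1 : √(1 - t) ^ α = (1 - t) ^ (α / 2 - 1) * (1 - t) := by
    rw [sqrt_eq_rpow, ← rpow_mul ht1.le, ← rpow_add_one ht1.ne']
    congr 1; ring
  have hsq := sq_sqrt ht0.le
  have hsq' := sq_sqrt ht1.le
  rw [h1]
  calc 1 / 2 * (1 - t) ^ (α / 2 - 1) = 1 / (2 * t) * (√t ^ 2 / √(1 - t) ^ 2) *
        ((1 - t) ^ (α / 2 - 1) * (1 - t)) := by rw [hsq, hsq']; field_simp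
    _ = _ := by ring

theorem inner_mehlerGradient (hα : 0 < α) (hα1 : α ≤ 1) (hC0 : 0 ≤ C) (hC : HolderConst α C h)
    (c : ℝ) (w v : EuclideanSpace ℝ (Fin d)) {t : ℝ} (ht : t ∈ Ioo (0 : ℝ) 1)
    (x : EuclideanSpace ℝ (Fin d)) :
    inner ℝ v (mehlerGradient h c w t x) = ∫ z, h (√t • x + √(1 - t) • z) *
      ((c + inner ℝ w z) * inner ℝ v z - inner ℝ v w) ∂(stdGaussian d) := by
  rw [mehlerGradient, ← integral_inner (integrable_mehlerGradient hα hα1 hC0 hC c w ht x)]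
  simp only [inner_smul_right, inner_sub_right]

theorem inner_mehlerGradient_one_zero (hα : 0 < α) (hα1 : α ≤ 1) (hC0 : 0 ≤ C)
    (hC : HolderConst α C h) (v : EuclideanSpace ℝ (Fin d)) {t : ℝ} (ht : t ∈ Ioo (0 : ℝ) 1)
    (x : EuclideanSpace ℝ (Fin d)) :
    inner ℝ v (mehlerGradient h 1 0 t x) = mehlerAffine h 0 v t x := by
  simp [inner_mehlerGradient hα hα1 hC0 hC 1 0 v ht x, mehlerAffine]

theorem pderivI_steinSol (hα : 0 < α) (hα1 : α ≤ 1) (hC0 : 0 ≤ C) (hC : HolderConst α C h)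
    (j : Fin d) (x : EuclideanSpace ℝ (Fin d)) :
    pderivI j (steinSol d h) x = -∫ t in Ioo (0 : ℝ) 1, 1 / (2 * t) * (√t / √(1 - t)) *
      mehlerAffine (hbar d h) 0 (EuclideanSpace.single j 1) t x := by
  have h1 := (hasFDerivAt_integral_mehlerAffine hα hα1 hC0 hC.hbar 1 0 x
    (k := fun t => 1 / (2 * t)) (by fun_prop) (integrableOn_mehlerAffine_hbar hα hα1 hC0 hC x)
    (integrableOn_first_order_weight hα)).fun_neg
  rw [pderivI, funext (steinSol_eq h), h1.fderiv, neg_apply,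
    innerSL_apply_apply, real_inner_comm, ← integral_inner (integrableOn_smul_mehlerGradient hα hα1
    hC0 hC.hbar 1 0 x (by fun_prop) (integrableOn_first_order_weight hα))]
  congr 1
  refine setIntegral_congr_fun measurableSet_Ioo fun t ht => ?_
  simp only [inner_smul_right]
  rw [inner_mehlerGradient_one_zero hα hα1 hC0 hC.hbar _ ht]

theorem integrableOn_mehlerAffine_zero (hα : 0 < α) (hα1 : α ≤ 1) (hC0 : 0 ≤ C)
    (hC : HolderConst α C h) (v x : EuclideanSpace ℝ (Fin d)) :
    IntegrableOn (fun t => 1 / (2 * t) * (√t / √(1 - t)) * mehlerAffine h 0 v t x) (Ioo 0 1) := by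
  have h1 : IntegrableOn (fun t => inner ℝ v ((1 / (2 * t) * (√t / √(1 - t))) •
      mehlerGradient h 1 0 t x)) (Ioo 0 1) :=
    (integrableOn_smul_mehlerGradient hα hα1 hC0 hC 1 0 x (by fun_prop)
      (integrableOn_first_order_weight hα)).const_inner v
  refine h1.congr_fun (fun t ht => ?_) measurableSet_Ioo
  simp only [inner_smul_right]
  rw [inner_mehlerGradient_one_zero hα hα1 hC0 hC _ ht]

theorem second_order_weight_eq {t : ℝ} (ht : t ∈ Ioo (0 : ℝ) 1) :
    1 / (2 * t) * (√t / √(1 - t)) * (√t / √(1 - t)) = 1 / (2 * (1 - t)) := by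
  have ht0 := ht.1
  have ht1 : 0 < 1 - t := by linarith [ht.2]
  calc _ = 1 / (2 * t) * (√t ^ 2 / √(1 - t) ^ 2) := by ring
    _ = _ := by rw [sq_sqrt ht0.le, sq_sqrt ht1.le]; field_simp

theorem integrableOn_hessian (hα : 0 < α) (hα1 : α ≤ 1) (hC0 : 0 ≤ C)
    (hC : HolderConst α C h) (v w x : EuclideanSpace ℝ (Fin d)) :
    IntegrableOn (fun t => 1 / (2 * (1 - t)) * inner ℝ v (mehlerGradient h 0 w t x))
      (Ioo 0 1) := by
  have h1 : IntegrableOn (fun t => inner ℝ v ((1 / (2 * t) * (√t / √(1 - t)) * (√t / √(1 - t))) •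
      mehlerGradient h 0 w t x)) (Ioo 0 1) :=
    (integrableOn_smul_mehlerGradient hα hα1 hC0 hC 0 w x (by fun_prop)
      (integrableOn_second_order_weight hα)).const_inner v
  refine h1.congr_fun (fun t ht => ?_) measurableSet_Ioo
  simp only [inner_smul_right]
  rw [second_order_weight_eq ht]

theorem hessEntry_steinSol (hα : 0 < α) (hα1 : α ≤ 1) (hC0 : 0 ≤ C) (hC : HolderConst α C h)
    (i j : Fin d) (x : EuclideanSpace ℝ (Fin d)) :
    hessEntry (steinSol d h) x i j = -∫ t in Ioo (0 : ℝ) 1, 1 / (2 * (1 - t)) *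
      inner ℝ (EuclideanSpace.single i 1)
        (mehlerGradient (hbar d h) 0 (EuclideanSpace.single j 1) t x) := by
  have h1 := (hasFDerivAt_integral_mehlerAffine hα hα1 hC0 hC.hbar 0 (EuclideanSpace.single j 1) x
    (k := fun t => 1 / (2 * t) * (√t / √(1 - t))) (by fun_prop)
    (integrableOn_mehlerAffine_zero hα hα1 hC0 hC.hbar _ x)
    (integrableOn_second_order_weight hα)).fun_neg
  rw [hessEntry, pderivI, funext (pderivI_steinSol hα hα1 hC0 hC j), h1.fderiv,
    neg_apply,
    innerSL_apply_apply, real_inner_comm, ← integral_inner (integrableOn_smul_mehlerGradient hα hα1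
    hC0 hC.hbar 0 _ x (by fun_prop) (integrableOn_second_order_weight hα))]
  congr 1
  refine setIntegral_congr_fun measurableSet_Ioo fun t ht => ?_
  simp only [inner_smul_right]
  rw [second_order_weight_eq ht]

/-- `E[h(√t x + √(1-t) Z) (‖Z‖² - d)]`. -/
noncomputable def mehlerLaplacian (h : EuclideanSpace ℝ (Fin d) → ℝ) (t : ℝ)
    (x : EuclideanSpace ℝ (Fin d)) : ℝ :=
  ∑ i, inner ℝ (EuclideanSpace.single i 1) (mehlerGradient h 0 (EuclideanSpace.single i 1) t x)

theorem integrableOn_mehlerLaplacian (hα : 0 < α) (hα1 : α ≤ 1) (hC0 : 0 ≤ C)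
    (hC : HolderConst α C h) (x : EuclideanSpace ℝ (Fin d)) :
    IntegrableOn (fun t => 1 / (2 * (1 - t)) * mehlerLaplacian h t x) (Ioo 0 1) := by
  simp only [mehlerLaplacian, Finset.mul_sum]
  exact integrable_finsetSum _ fun i _ => integrableOn_hessian hα hα1 hC0 hC _ _ x

theorem laplacian_steinSol (hα : 0 < α) (hα1 : α ≤ 1) (hC0 : 0 ≤ C) (hC : HolderConst α C h)
    (x : EuclideanSpace ℝ (Fin d)) :
    laplacian (steinSol d h) x =
      -∫ t in Ioo (0 : ℝ) 1, 1 / (2 * (1 - t)) * mehlerLaplacian (hbar d h) t x := by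
  simp only [laplacian, mehlerLaplacian, Finset.mul_sum, hessEntry_steinSol hα hα1 hC0 hC]
  rw [integral_finsetSum _ fun i _ => integrableOn_hessian hα hα1 hC0 hC.hbar _ _ x,
    Finset.sum_neg_distrib]

end SteinSolution

section Moments

variable {d : ℕ}

theorem integral_rpow_norm_mul_exp (hd : 1 ≤ d) {q : ℝ} (hq : 0 ≤ q) :
    ∫ z : EuclideanSpace ℝ (Fin d), exp (-‖z‖ ^ 2 / 2) * ‖z‖ ^ q =
      d * (volume : Measure (EuclideanSpace ℝ (Fin d))).real (Metric.ball 0 1) *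
        ((1 / 2) ^ (-(d + q) / 2) * (1 / 2) * Gamma ((d + q) / 2)) := by
  have : Nonempty (Fin d) := ⟨⟨0, hd⟩⟩
  have h1 := integral_fun_norm_addHaar (volume : Measure (EuclideanSpace ℝ (Fin d)))
    (fun r => exp (-r ^ 2 / 2) * r ^ q)
  have hd' : (1 : ℝ) ≤ d := by exact_mod_cast hd
  have h2 := integral_rpow_mul_exp_neg_mul_rpow (p := 2) (q := d - 1 + q) (b := 1 / 2)
    (by norm_num) (by linarith) (by norm_num)
  have h3 : ∫ y in Ioi (0 : ℝ), y ^ (d - 1) • (exp (-y ^ 2 / 2) * y ^ q) =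
      ∫ y in Ioi (0 : ℝ), y ^ (d - 1 + q : ℝ) * exp (-(1 / 2) * y ^ (2 : ℝ)) := by
    refine setIntegral_congr_fun measurableSet_Ioi fun y hy => ?_
    have hy0 : 0 < y := hy
    simp only [smul_eq_mul]
    rw [rpow_add hy0, ← Nat.cast_pred hd, rpow_natCast, rpow_two,
      show -(1 / 2) * y ^ 2 = -y ^ 2 / 2 by ring]
    ring
  rw [h1, finrank_euclideanSpace_fin, h3, h2, nsmul_eq_mul, smul_eq_mul,
    show (d - 1 + q + 1 : ℝ) = d + q by ring]
  ring

theorem integral_rpow_norm_stdGaussian (hd : 1 ≤ d) {q : ℝ} (hq : 0 ≤ q) :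
    ∫ z, ‖z‖ ^ q ∂(stdGaussian d) = 2 ^ (q / 2) * Gamma ((d + q) / 2) / Gamma (d / 2) := by
  have : Nonempty (Fin d) := ⟨⟨0, hd⟩⟩
  have h0 := integral_rpow_norm_mul_exp hd (le_refl (0 : ℝ))
  simp only [rpow_zero, mul_one, add_zero] at h0
  have hpos := integral_exp_neg_norm_sq_div_two_pos (d := d)
  have hd' : (0 : ℝ) < d := by exact_mod_cast hd
  have hG := Gamma_pos_of_pos (half_pos hd')
  rw [integral_stdGaussian]
  simp only [smul_eq_mul]
  rw [integral_rpow_norm_mul_exp hd hq]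
  rw [h0] at hpos ⊢
  set V := (volume : Measure (EuclideanSpace ℝ (Fin d))).real (Metric.ball 0 1)
  have hV : V ≠ 0 := by
    rintro hV
    simp [hV] at hpos
  have h4 : (1 / 2 : ℝ) ^ (-(d + q) / 2) = (1 / 2 : ℝ) ^ (-(d : ℝ) / 2) * 2 ^ (q / 2) := by
    rw [show -(d + q) / 2 = -(d : ℝ) / 2 + -(q / 2) by ring, rpow_add (by norm_num),
      rpow_neg (by norm_num) (q / 2), ← inv_rpow (by norm_num)]
    norm_num
  have h5 : (0 : ℝ) < (1 / 2 : ℝ) ^ (-(d : ℝ) / 2) := by positivity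
  rw [h4]
  field_simp

theorem integrable_rpow_norm_stdGaussian {q : ℝ} (hq : 0 ≤ q) :
    Integrable (fun z => ‖z‖ ^ q) (stdGaussian d) := by
  simpa using integrable_norm_rpow_mul (d := d) hq (g := fun _ => (1 : ℝ)) continuous_const
    (A := 1) (c := 0) (by simp)

theorem integral_rpow_norm_mul_stdGaussian (hd : 1 ≤ d) {α : ℝ} (hα : 0 < α) :
    ∫ z, ‖z‖ ^ α * (‖z‖ ^ 2 + d) ∂(stdGaussian d) =
      2 ^ (α / 2) * (α + 2 * d) * Gamma ((α + d) / 2) / Gamma (d / 2) := by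
  have hd' : (0 : ℝ) < d := by exact_mod_cast hd
  have h1 : ∀ z : EuclideanSpace ℝ (Fin d), ‖z‖ ^ α * (‖z‖ ^ 2 + d) =
      ‖z‖ ^ (α + 2) + d * ‖z‖ ^ α := fun z => by
    rw [← rpow_two, mul_add, ← rpow_add' (norm_nonneg _) (by positivity)]; ring
  simp only [h1]
  rw [integral_add (integrable_rpow_norm_stdGaussian (by positivity))
    ((integrable_rpow_norm_stdGaussian hα.le).const_mul _), integral_const_mul,
    integral_rpow_norm_stdGaussian hd (by positivity), integral_rpow_norm_stdGaussian hd hα.le,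
    show (d + (α + 2)) / 2 = (α + d) / 2 + 1 by ring, Gamma_add_one (by positivity),
    show (α + 2) / 2 = α / 2 + 1 by ring, rpow_add_one (by norm_num), add_comm (d : ℝ) α]
  ring

end Moments

section LaplacianBounds

variable {d : ℕ} {α C : ℝ} {h : EuclideanSpace ℝ (Fin d) → ℝ}

theorem inner_single_one_left (i : Fin d) (z : EuclideanSpace ℝ (Fin d)) :
    inner ℝ (EuclideanSpace.single i (1 : ℝ)) z = z i := by
  simp [EuclideanSpace.inner_single_left]

theorem integrable_comp_mul_norm_sq_sub (hα : 0 < α) (hα1 : α ≤ 1) (hC0 : 0 ≤ C)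
    (hC : HolderConst α C h) {t : ℝ} (ht : t ∈ Ioo (0 : ℝ) 1) (x : EuclideanSpace ℝ (Fin d)) :
    Integrable (fun z => h (√t • x + √(1 - t) • z) * (‖z‖ ^ 2 - d)) (stdGaussian d) := by
  have hh := hC.continuous hα
  refine integrable_stdGaussian_of_norm_le (A := (|h (√t • x)| + C) * (1 + d)) (c := 3)
    (by fun_prop) fun z => ?_
  have h1 := hC.abs_le_exp hα hα1 hC0 (√t • x) (abs_sqrt_one_sub_le_one ht) z
  have h2 : |‖z‖ ^ 2 - d| ≤ (1 + d) * exp (2 * ‖z‖) := by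
    have h3 : ‖z‖ ≤ exp ‖z‖ := by linarith [add_one_le_exp ‖z‖]
    have h4 : ‖z‖ ^ 2 ≤ exp (2 * ‖z‖) := by
      rw [mul_comm, exp_mul, rpow_two]; gcongr
    have h5 : 1 ≤ exp (2 * ‖z‖) := one_le_exp (by positivity)
    have h6 : (0 : ℝ) ≤ d := d.cast_nonneg
    rw [abs_le]
    constructor <;> nlinarith [sq_nonneg ‖z‖]
  rw [norm_mul, norm_eq_abs, norm_eq_abs]
  calc |h (√t • x + √(1 - t) • z)| * |‖z‖ ^ 2 - d|
      ≤ ((|h (√t • x)| + C) * exp ‖z‖) * ((1 + d) * exp (2 * ‖z‖)) := by gcongr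
    _ = (|h (√t • x)| + C) * (1 + d) * (exp ‖z‖ * exp (2 * ‖z‖)) := by ring
    _ = _ := by rw [← exp_add]; congr 2; ring

theorem mehlerLaplacian_eq_integral (hα : 0 < α) (hα1 : α ≤ 1) (hC0 : 0 ≤ C)
    (hC : HolderConst α C h) {t : ℝ} (ht : t ∈ Ioo (0 : ℝ) 1) (x : EuclideanSpace ℝ (Fin d)) :
    mehlerLaplacian h t x =
      ∫ z, h (√t • x + √(1 - t) • z) * (‖z‖ ^ 2 - d) ∂(stdGaussian d) := by
  have h1 : ∀ i, inner ℝ (EuclideanSpace.single i 1)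
      (mehlerGradient h 0 (EuclideanSpace.single i 1) t x) = ∫ z, inner ℝ (EuclideanSpace.single i 1)
      (h (√t • x + √(1 - t) • z) • ((0 + inner ℝ (EuclideanSpace.single i 1) z) • z -
        EuclideanSpace.single i 1)) ∂(stdGaussian d) := fun i =>
    (integral_inner (integrable_mehlerGradient hα hα1 hC0 hC 0 _ ht x) _).symm
  rw [mehlerLaplacian, Finset.sum_congr rfl fun i _ => h1 i, ← integral_finsetSum _ fun i _ =>
    (integrable_mehlerGradient hα hα1 hC0 hC 0 _ ht x).const_inner _]
  congr with z
  simp only [inner_smul_right, inner_sub_right, inner_single_one_left, ← Finset.mul_sum]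
  congr 1
  rw [EuclideanSpace.norm_sq_eq]
  simp [sq, Finset.sum_sub_distrib]

theorem integrable_norm_sq_sub (d : ℕ) :
    Integrable (fun z => ‖z‖ ^ 2 - (d : ℝ)) (stdGaussian d) := by
  simpa using integrable_comp_mul_norm_sq_sub (d := d) (α := 1) (C := 0) (h := fun _ => 1) one_pos
    le_rfl le_rfl (by simp [HolderConst]) (t := 1 / 2) (by norm_num) 0

theorem integral_norm_sq_sub (d : ℕ) : ∫ z, (‖z‖ ^ 2 - (d : ℝ)) ∂(stdGaussian d) = 0 := by
  have h1 := mehlerLaplacian_eq_integral (d := d) (α := 1) (C := 0) (h := fun _ => 1) one_pos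
    le_rfl le_rfl (by simp [HolderConst]) (t := 1 / 2) (by norm_num) 0
  simp only [mehlerLaplacian, mehlerGradient, one_smul, integral_affine_smul_sub, inner_zero_right,
    Finset.sum_const_zero, one_mul] at h1
  exact h1.symm

theorem integrable_norm_sq (d : ℕ) : Integrable (fun z => ‖z‖ ^ 2) (stdGaussian d) := by
  exact ((integrable_norm_sq_sub d).add (integrable_const (d : ℝ))).congr
    (ae_of_all _ fun z => sub_add_cancel _ _)

theorem integral_norm_sq (d : ℕ) : ∫ z, ‖z‖ ^ 2 ∂(stdGaussian d) = d := by
  have h1 := integral_norm_sq_sub d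
  rw [integral_sub (integrable_norm_sq d) (integrable_const _)] at h1
  simpa [sub_eq_zero] using h1

theorem integral_abs_norm_sq_sub_le (d : ℕ) :
    ∫ z, |‖z‖ ^ 2 - (d : ℝ)| ∂(stdGaussian d) ≤ 2 * d := by
  calc ∫ z, |‖z‖ ^ 2 - (d : ℝ)| ∂(stdGaussian d)
      ≤ ∫ z, (‖z‖ ^ 2 + (d : ℝ)) ∂(stdGaussian d) := by
        refine integral_mono (integrable_norm_sq_sub d).abs
          ((integrable_norm_sq d).add (integrable_const _)) fun z => ?_
        have h6 : (0 : ℝ) ≤ d := d.cast_nonneg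
        simp only [abs_le]
        constructor <;> linarith [sq_nonneg ‖z‖]
    _ = 2 * d := by
        rw [integral_add (integrable_norm_sq d) (integrable_const _), integral_norm_sq]
        simp [two_mul]

theorem abs_mehlerLaplacian_sub_le (hα : 0 < α) (hα1 : α ≤ 1) (hC0 : 0 ≤ C)
    (hC : HolderConst α C h) {t : ℝ} (ht : t ∈ Ioo (0 : ℝ) 1) (x y : EuclideanSpace ℝ (Fin d)) :
    |mehlerLaplacian h t x - mehlerLaplacian h t y| ≤ 2 * d * C * dist x y ^ α := by
  rw [mehlerLaplacian_eq_integral hα hα1 hC0 hC ht, mehlerLaplacian_eq_integral hα hα1 hC0 hC ht,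
    ← integral_sub (integrable_comp_mul_norm_sq_sub hα hα1 hC0 hC ht x)
      (integrable_comp_mul_norm_sq_sub hα hα1 hC0 hC ht y), ← norm_eq_abs]
  have h1 := norm_integral_le_of_norm_le (f := fun z => h (√t • x + √(1 - t) • z) * (‖z‖ ^ 2 - d) -
    h (√t • y + √(1 - t) • z) * (‖z‖ ^ 2 - d))
    ((integrable_norm_sq_sub d).abs.const_mul (C * dist x y ^ α)) (ae_of_all _ fun z => ?_)
  · refine h1.trans ?_
    rw [integral_const_mul]
    calc C * dist x y ^ α * ∫ z, |‖z‖ ^ 2 - (d : ℝ)| ∂(stdGaussian d)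
        ≤ C * dist x y ^ α * (2 * d) := by gcongr; exact integral_abs_norm_sq_sub_le d
      _ = _ := by ring
  · rw [← sub_mul, norm_mul, norm_eq_abs, norm_eq_abs]
    gcongr
    refine (hC _ _).trans ?_
    gcongr
    rw [dist_add_right, dist_smul₀, norm_of_nonneg (sqrt_nonneg t)]
    exact mul_le_of_le_one_left dist_nonneg (sqrt_le_one.2 ht.2.le)

theorem abs_mehlerLaplacian_le (hα : 0 < α) (hα1 : α ≤ 1) (hC0 : 0 ≤ C)
    (hC : HolderConst α C h) {t : ℝ} (ht : t ∈ Ioo (0 : ℝ) 1) (x : EuclideanSpace ℝ (Fin d)) :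
    |mehlerLaplacian h t x| ≤
      C * (∫ z, ‖z‖ ^ α * (‖z‖ ^ 2 + d) ∂(stdGaussian d)) * √(1 - t) ^ α := by
  have hint : Integrable (fun z => ‖z‖ ^ α * (‖z‖ ^ 2 + d)) (stdGaussian d) := by
    have h1 := (integrable_rpow_norm_stdGaussian (d := d) (q := α + 2) (by positivity)).add
      ((integrable_rpow_norm_stdGaussian (d := d) hα.le).const_mul (d : ℝ))
    refine h1.congr (ae_of_all _ fun z => ?_)
    simp only [Pi.add_apply]
    rw [rpow_add' (norm_nonneg _) (by positivity), rpow_two]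
    ring
  have h1 : mehlerLaplacian h t x = ∫ z, (h (√t • x + √(1 - t) • z) - h (√t • x)) *
      (‖z‖ ^ 2 - d) ∂(stdGaussian d) := by
    simp_rw [sub_mul]
    rw [integral_sub (integrable_comp_mul_norm_sq_sub hα hα1 hC0 hC ht x)
      ((integrable_norm_sq_sub d).const_mul _), integral_const_mul, integral_norm_sq_sub,
      mul_zero, sub_zero, mehlerLaplacian_eq_integral hα hα1 hC0 hC ht]
  rw [h1, show C * (∫ z, ‖z‖ ^ α * (‖z‖ ^ 2 + d) ∂(stdGaussian d)) * √(1 - t) ^ α =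
    C * √(1 - t) ^ α * ∫ z, ‖z‖ ^ α * (‖z‖ ^ 2 + d) ∂(stdGaussian d) by ring,
    ← integral_const_mul, ← norm_eq_abs]
  refine norm_integral_le_of_norm_le (hint.const_mul _) (ae_of_all _ fun z => ?_)
  rw [norm_mul, norm_eq_abs, norm_eq_abs, ← mul_assoc]
  have h6 : (0 : ℝ) ≤ d := d.cast_nonneg
  gcongr
  · exact hC.abs_sub_mehler_le x z
  · rw [abs_le]
    constructor <;> linarith [sq_nonneg ‖z‖]

theorem integrable_sq_inner (w : EuclideanSpace ℝ (Fin d)) :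
    Integrable (fun z => inner ℝ w z * inner ℝ w z) (stdGaussian d) := by
  refine ((integrable_norm_sq d).const_mul (‖w‖ ^ 2)).mono' (by fun_prop)
    (ae_of_all _ fun z => ?_)
  rw [norm_mul, ← mul_pow, sq]
  gcongr <;> exact norm_inner_le_norm _ _

theorem integral_sq_inner (w : EuclideanSpace ℝ (Fin d)) :
    ∫ z, inner ℝ w z * inner ℝ w z ∂(stdGaussian d) = ‖w‖ ^ 2 := by
  have hi : Integrable (fun z => (0 + inner ℝ w z) • z - w) (stdGaussian d) := by
    simpa using integrable_smul_affine_smul_sub (G := fun _ : EuclideanSpace ℝ (Fin d) => (1 : ℝ))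
      continuous_const (A := 1) (fun z => by simp) 0 w
  have h1 := integral_inner (𝕜 := ℝ) hi w
  rw [integral_affine_smul_sub, inner_zero_right] at h1
  simp only [zero_add, inner_sub_right, inner_smul_right, real_inner_self_eq_norm_sq] at h1
  rw [integral_sub (integrable_sq_inner w) (integrable_const _), sub_eq_zero] at h1
  simpa using h1

theorem integrable_abs_inner (w : EuclideanSpace ℝ (Fin d)) :
    Integrable (fun z => |inner ℝ w z|) (stdGaussian d) := by
  refine ((integrable_sq_inner w).add (integrable_const 1)).mono' (by fun_prop)
    (ae_of_all _ fun z => ?_)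
  rw [norm_eq_abs, abs_abs, Pi.add_apply, ← abs_mul_abs_self]
  nlinarith [abs_nonneg (inner ℝ w z), sq_nonneg (|inner ℝ w z| - 1)]

theorem integral_abs_inner_le {w : EuclideanSpace ℝ (Fin d)} (hw : ‖w‖ = 1) :
    ∫ z, |inner ℝ w z| ∂(stdGaussian d) ≤ 1 := by
  calc ∫ z, |inner ℝ w z| ∂(stdGaussian d)
      ≤ ∫ z, (1 / 2 * (inner ℝ w z * inner ℝ w z) + 1 / 2) ∂(stdGaussian d) := by
        refine integral_mono (integrable_abs_inner w)
          (((integrable_sq_inner w).const_mul _).add (integrable_const _)) fun z => ?_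
        simp only
        rw [← abs_mul_abs_self (inner ℝ w z)]
        nlinarith [sq_nonneg (|inner ℝ w z| - 1)]
    _ = 1 := by
        rw [integral_add ((integrable_sq_inner w).const_mul _) (integrable_const _),
          integral_const_mul, integral_sq_inner, hw]
        norm_num

/-- For Lipschitz `h` one derivative may be moved onto `h`. -/
theorem norm_mehlerGradient_le_of_lipschitz (hC0 : 0 ≤ C) (hC : HolderConst 1 C h)
    {w : EuclideanSpace ℝ (Fin d)} (hw : ‖w‖ = 1) {t : ℝ} (ht : t ∈ Ioo (0 : ℝ) 1)
    (x : EuclideanSpace ℝ (Fin d)) : ‖mehlerGradient h 0 w t x‖ ≤ C * √(1 - t) := by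
  have ht0 := sqrt_pos.2 ht.1
  have ht1 : 0 < √(1 - t) := sqrt_pos.2 (by linarith [ht.2])
  have h1 := (hasFDerivAt_mehlerAffine one_pos le_rfl hC0 hC 0 w ht x).le_of_lip'
    (C := C * √t) (by positivity) (Eventually.of_forall fun y => ?_)
  · rw [innerSL_apply_norm, norm_smul, norm_of_nonneg (by positivity)] at h1
    rw [← mul_le_mul_iff_right₀ (show 0 < √t / √(1 - t) by positivity)]
    refine h1.trans_eq ?_
    field_simp
  · rw [mehlerAffine, mehlerAffine, ← integral_sub
      (integrable_mehlerAffine one_pos le_rfl hC0 hC 0 w ht y)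
      (integrable_mehlerAffine one_pos le_rfl hC0 hC 0 w ht x)]
    have h2 := norm_integral_le_of_norm_le (f := fun z =>
      h (√t • y + √(1 - t) • z) * (0 + inner ℝ w z) - h (√t • x + √(1 - t) • z) * (0 + inner ℝ w z))
      ((integrable_abs_inner w).const_mul (C * √t * ‖y - x‖)) (ae_of_all _ fun z => ?_)
    · refine h2.trans ?_
      rw [integral_const_mul]
      exact mul_le_of_le_one_right (by positivity) (integral_abs_inner_le hw)
    · rw [← sub_mul, norm_mul, norm_eq_abs, norm_eq_abs, zero_add]
      gcongr
      refine (hC _ _).trans_eq ?_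
      rw [rpow_one, dist_add_right, dist_smul₀, norm_of_nonneg ht0.le, dist_eq_norm, mul_assoc]

theorem abs_mehlerLaplacian_le_of_lipschitz (hC0 : 0 ≤ C) (hC : HolderConst 1 C h)
    {t : ℝ} (ht : t ∈ Ioo (0 : ℝ) 1) (x : EuclideanSpace ℝ (Fin d)) :
    |mehlerLaplacian h t x| ≤ C * d * √(1 - t) := by
  calc |mehlerLaplacian h t x|
      ≤ ∑ _i : Fin d, C * √(1 - t) := by
        refine (Finset.abs_sum_le_sum_abs _ _).trans (Finset.sum_le_sum fun i _ => ?_)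
        have hn : ‖(EuclideanSpace.single i 1 : EuclideanSpace ℝ (Fin d))‖ = 1 := by simp
        refine (abs_real_inner_le_norm _ _).trans ?_
        rw [hn, one_mul]
        exact norm_mehlerGradient_le_of_lipschitz hC0 hC hn ht x
    _ = _ := by simp; ring

/-- Interpolation between the size and the increments of the Laplacian of the semigroup. -/
theorem abs_laplacian_steinSol_sub_le (hα : 0 < α) (hα1 : α ≤ 1) (hC0 : 0 ≤ C)
    (hC : HolderConst α C h) {B : ℝ} (hB0 : 0 ≤ B)
    (hB : ∀ t ∈ Ioo (0 : ℝ) 1, ∀ x, |mehlerLaplacian (hbar d h) t x| ≤ C * B * √(1 - t) ^ α)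
    {β : ℝ} (hβ : β ∈ Ioo 0 α) (x y : EuclideanSpace ℝ (Fin d)) :
    |laplacian (steinSol d h) x - laplacian (steinSol d h) y| ≤
      ((1 - β / α) * B + β / α * d) * (2 / (α - β)) * dist x y ^ β * C := by
  have hβ0 := hβ.1
  have hd0 : (0 : ℝ) ≤ d := d.cast_nonneg
  have hβα : β / α ≤ 1 := (div_le_one hα).2 hβ.2.le
  have hβα0 : 0 ≤ β / α := by positivity
  rw [laplacian_steinSol hα hα1 hC0 hC, laplacian_steinSol hα hα1 hC0 hC, neg_sub_neg,
    abs_sub_comm, ← integral_sub (integrableOn_mehlerLaplacian hα hα1 hC0 hC.hbar x)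
      (integrableOn_mehlerLaplacian hα hα1 hC0 hC.hbar y)]
  have hpt : ∀ t ∈ Ioo (0 : ℝ) 1,
      |mehlerLaplacian (hbar d h) t x - mehlerLaplacian (hbar d h) t y| ≤
      2 * C * (((1 - β / α) * B + β / α * d) * ((1 - t) ^ ((α - β) / 2) * dist x y ^ β)) := by
    intro t ht
    have ht1 : 0 < 1 - t := by linarith [ht.2]
    set D := |mehlerLaplacian (hbar d h) t x - mehlerLaplacian (hbar d h) t y|
    set S := √(1 - t) ^ α
    have hS : 0 ≤ S := by positivity
    set R := dist x y ^ α
    have hR : 0 ≤ R := by positivity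
    have h1 : D ≤ 2 * C * (B * S) := by
      have := abs_sub (mehlerLaplacian (hbar d h) t x) (mehlerLaplacian (hbar d h) t y)
      have h2 := hB t ht x
      have h3 := hB t ht y
      linarith
    have h2 : D ≤ 2 * C * (d * R) :=
      (abs_mehlerLaplacian_sub_le hα hα1 hC0 hC.hbar ht x y).trans_eq (by ring)
    have h3 : D ≤ (2 * C * (B * S)) ^ (1 - β / α) * (2 * C * (d * R)) ^ (β / α) := by
      have hD : 0 ≤ D := abs_nonneg _
      calc D = D ^ (1 - β / α) * D ^ (β / α) := by
            rw [← rpow_add' hD (by simp), sub_add_cancel, rpow_one]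
        _ ≤ _ := by gcongr
    have hSR : S ^ (1 - β / α) * R ^ (β / α) = (1 - t) ^ ((α - β) / 2) * dist x y ^ β := by
      simp only [S, R]
      rw [← rpow_mul (sqrt_nonneg _), ← rpow_mul dist_nonneg, sqrt_eq_rpow, ← rpow_mul ht1.le]
      congr 2 <;> field_simp
    calc D ≤ _ := h3
      _ = ((2 * C) ^ (1 - β / α) * (2 * C) ^ (β / α)) * ((B ^ (1 - β / α) * (d : ℝ) ^ (β / α)) *
          (S ^ (1 - β / α) * R ^ (β / α))) := by
          have hC2 : 0 ≤ 2 * C := by positivity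
          rw [mul_rpow hC2 (by positivity), mul_rpow hB0 hS, mul_rpow hC2 (by positivity),
            mul_rpow hd0 hR]
          ring
      _ = 2 * C * ((B ^ (1 - β / α) * (d : ℝ) ^ (β / α)) *
          ((1 - t) ^ ((α - β) / 2) * dist x y ^ β)) := by
          rw [← rpow_add' (by positivity) (by simp), sub_add_cancel, rpow_one, hSR]
      _ ≤ _ := by
          gcongr
          exact geom_mean_le_arith_mean2_weighted (by linarith) hβα0 hB0 hd0 (by ring)
  have hp : -1 < (α - β) / 2 - 1 := by linarith [hβ.2]
  have hint := (integrableOn_one_sub_rpow_Ioo hp).const_mul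
    (C * (((1 - β / α) * B + β / α * d) * dist x y ^ β))
  rw [← norm_eq_abs]
  refine (norm_integral_le_of_norm_le hint
    (ae_restrict_of_forall_mem measurableSet_Ioo fun t ht => ?_)).trans_eq ?_
  · have ht1 : 0 < 1 - t := by linarith [ht.2]
    rw [← mul_sub, norm_mul, norm_of_nonneg (by positivity), norm_eq_abs, rpow_sub_one ht1.ne']
    calc _ ≤ 1 / (2 * (1 - t)) * _ := mul_le_mul_of_nonneg_left (hpt t ht) (by positivity)
      _ = _ := by field_simp
  · rw [integral_const_mul, integral_one_sub_rpow_Ioo hp]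
    rw [sub_add_cancel, one_div_div]
    ring

end LaplacianBounds

/-- **Proposition 2.3, display (2.15)**: the Laplacian of Barbour's solution is globally
`β`-Hölder for every `0 < β < α`. -/
theorem steinSol_laplacian_beta_holder
    {d : ℕ} (hd : 1 ≤ d) {α : ℝ} (hα : α ∈ Set.Ioc (0 : ℝ) 1)
    (h : EuclideanSpace ℝ (Fin d) → ℝ)
    {C : ℝ} (hC0 : 0 ≤ C) (hC : HolderConst α C h) :
    ∀ β ∈ Set.Ioo (0 : ℝ) α, ∀ x y : EuclideanSpace ℝ (Fin d),
      |laplacian (steinSol d h) x - laplacian (steinSol d h) y| ≤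
        (C2 α d + d * (2 / (α - β))) * dist x y ^ β * C := by
  intro β hβ x y
  obtain ⟨hα0, hα1⟩ := hα
  have hβ0 := hβ.1
  have hd' : (0 : ℝ) < d := by exact_mod_cast hd
  have hθ : β / α ≤ 1 := (div_le_one hα0).2 hβ.2.le
  have hαβ : 0 < α - β := sub_pos.2 hβ.2
  rcases eq_or_ne α 1 with rfl | hne
  · refine (abs_laplacian_steinSol_sub_le hα0 hα1 hC0 hC hd'.le (fun t ht x => ?_) hβ x y).trans ?_
    · rw [rpow_one]
      exact abs_mehlerLaplacian_le_of_lipschitz hC0 hC.hbar ht x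
    · have hC2 : 0 ≤ C2 1 d := by rw [C2, if_pos rfl]; positivity
      rw [← add_mul, sub_add_cancel, one_mul]
      gcongr
      linarith
  · have hB := integral_rpow_norm_mul_stdGaussian hd hα0
    set B := ∫ z, ‖z‖ ^ α * (‖z‖ ^ 2 + d) ∂(stdGaussian d)
    have hB0 : 0 ≤ B := integral_nonneg fun z => by positivity
    refine (abs_laplacian_steinSol_sub_le hα0 hα1 hC0 hC hB0 (fun t ht x =>
      abs_mehlerLaplacian_le hα0 hα1 hC0 hC.hbar ht x) hβ x y).trans ?_
    have hC2 : C2 α d = (1 - β / α) * B * (2 / (α - β)) := by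
      have hG : Gamma ((d : ℝ) / 2) ≠ 0 := (Gamma_pos_of_pos (half_pos hd')).ne'
      rw [C2, if_neg hne, hB, rpow_add_one (by norm_num)]
      field_simp
    rw [hC2, add_mul]
    gcongr
    exact mul_le_of_le_one_left hd'.le hθ
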